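/- Let q ≥ 2 and n ≥ 1 be integers and δ ≥ 0 be real. Fix y ∈ Z_q^n and let X be a uniformly distributed random vector on Z_q^n. Then the probability that X lies in the Lee ball of radius nδ around y satisfies P(d_L(X, y) ≤ nδ) ≤ exp(−n·(log q − H⁺_δ)), where H⁺_δ = inf_{β ≥ 0} (β·δ + log Z(β)). -/

import Mathlib

/-- The Lee weight of an element of `ZMod q`: `min(a, q - a)` for the least
nonnegative residue `a`. -/
def leeWt (q : ℕ) [NeZero q] (a : ZMod q) : ℕ := min a.val (q - a.val)

/-- The Lee weight of a vector: `w_L(x) = ∑_i w_L(x_i)`. -/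
def leeWtVec (q n : ℕ) [NeZero q] (x : Fin n → ZMod q) : ℕ :=
  ∑ i, leeWt q (x i)

/-- The Lee distance of two vectors: `d_L(x,y) = w_L(x - y)`. -/
def dLeeVec (q n : ℕ) [NeZero q] (x y : Fin n → ZMod q) : ℕ :=
  leeWtVec q n (x - y)

/-- The partition function `Z(β) = ∑_{e ∈ Z_q} exp(-β · w_L(e))`. -/
noncomputable def Zfun (q : ℕ) [NeZero q] (β : ℝ) : ℝ :=
  ∑ e : ZMod q, Real.exp (-β * (leeWt q e : ℝ))

/-- `H⁺_δ = inf_{β ≥ 0} (β·δ + log Z(β))`. -/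
noncomputable def Hplus (q : ℕ) [NeZero q] (δ : ℝ) : ℝ :=
  ⨅ β : {b : ℝ // 0 ≤ b}, ((β : ℝ) * δ + Real.log (Zfun q (β : ℝ)))

lemma Zfun_pos (q : ℕ) [NeZero q] (β : ℝ) : 0 < Zfun q β :=
  Finset.sum_pos (fun _ _ => Real.exp_pos _) Finset.univ_nonempty

/-- The partition function of the Lee distance to `y` on `Z_q^n` is `Z(β)^n`. -/
lemma sum_exp_dLeeVec (q n : ℕ) [NeZero q] (β : ℝ) (y : Fin n → ZMod q) :
    ∑ x, Real.exp (-β * (dLeeVec q n x y : ℝ)) = Zfun q β ^ n := by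
  rw [Zfun, Fintype.sum_pow]
  refine Fintype.sum_equiv (Equiv.subRight y) _ _ fun x => ?_
  simp only [dLeeVec, leeWtVec, Equiv.subRight_apply, Nat.cast_sum, Finset.mul_sum, Real.exp_sum]

/-- Chernoff bound for the size of a Lee ball. -/
lemma card_lee_ball_le (q n : ℕ) [NeZero q] {β : ℝ} (hβ : 0 ≤ β) (r : ℝ) (y : Fin n → ZMod q) :
    (Nat.card {x : Fin n → ZMod q // (dLeeVec q n x y : ℝ) ≤ r} : ℝ)
      ≤ Real.exp (β * r) * Zfun q β ^ n := by
  classical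
  rw [Nat.card_eq_fintype_card, Fintype.card_subtype, Finset.card_eq_sum_ones, Nat.cast_sum,
    Finset.sum_filter, ← sum_exp_dLeeVec q n β y, Finset.mul_sum]
  refine Finset.sum_le_sum fun x _ => ?_
  split_ifs with hx
  · rw [← Real.exp_add, Nat.cast_one, Real.one_le_exp_iff]
    nlinarith [mul_le_mul_of_nonneg_left hx hβ]
  · positivity

/-- For a uniformly distributed `X` on `Z_q^n` and any fixed `y ∈ Z_q^n`, the
probability that `X` lies in the Lee ball of radius `nδ` around `y` is at most
`exp(-n(log q - H⁺_δ))`. -/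
theorem uniform_prob_lee_ball_le (q n : ℕ) [NeZero q] (hq : 2 ≤ q)
    (hn : 1 ≤ n) (δ : ℝ) (hδ : 0 ≤ δ) (y : Fin n → ZMod q) :
    (Nat.card {x : Fin n → ZMod q // (dLeeVec q n x y : ℝ) ≤ n * δ} : ℝ) / (q : ℝ) ^ n
      ≤ Real.exp (-(n : ℝ) * (Real.log q - Hplus q δ)) := by
  have hq0 : (0 : ℝ) < q := by exact_mod_cast (by omega : 0 < q)
  have hn0 : (0 : ℝ) < n := by exact_mod_cast hn
  have hy : (dLeeVec q n y y : ℝ) ≤ n * δ := by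
    have : dLeeVec q n y y = 0 := by simp [dLeeVec, leeWtVec, leeWt]
    rw [this, Nat.cast_zero]
    positivity
  have : Nonempty {x : Fin n → ZMod q // (dLeeVec q n x y : ℝ) ≤ n * δ} := ⟨⟨y, hy⟩⟩
  have hcard : (0 : ℝ) < Nat.card {x : Fin n → ZMod q // (dLeeVec q n x y : ℝ) ≤ n * δ} := by
    exact_mod_cast Nat.card_pos
  set N : ℝ := (Nat.card {x : Fin n → ZMod q // (dLeeVec q n x y : ℝ) ≤ n * δ} : ℝ)
  have : Nonempty {b : ℝ // 0 ≤ b} := ⟨⟨0, le_rfl⟩⟩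
  have hH : Real.log N / n ≤ Hplus q δ := by
    refine le_ciInf fun β => ?_
    have h := Real.log_le_log hcard (card_lee_ball_le q n β.2 (n * δ) y)
    rw [Real.log_mul (Real.exp_pos _).ne' (pow_pos (Zfun_pos q _) n).ne', Real.log_exp,
      Real.log_pow] at h
    rw [div_le_iff₀ hn0]
    linarith
  rw [div_le_iff₀ hn0] at hH
  rw [← Real.log_le_iff_le_exp (by positivity), Real.log_div hcard.ne' (by positivity),
    Real.log_pow]
  linarith
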